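/- There is no twice differentiable curve γ : ℝ → ℝ² ∖ {(0,0)}, γ(t) = (x(t), y(t)), satisfying x''(t) = 2 x(t) x'(t)² / (x(t)² + y(t)²) and y''(t) = 2 y(t) y'(t)² / (x(t)² + y(t)²) for all t ∈ ℝ together with γ(0) = (1, 0) and γ'(0) = (1, 0). -/

import Mathlib

theorem const_of_hasDerivAt_zero (f : ℝ → ℝ) (h : ∀ t, HasDerivAt f 0 t) (t : ℝ) :
    f t = f 0 :=
  is_const_of_deriv_eq_zero (fun s => (h s).differentiableAt) (fun s => (h s).deriv) t 0


/-- The incompleteness assertion of Example 1(1): there is no globally defined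
twice differentiable curve `γ = (x, y) : ℝ → ℝ² ∖ {(0,0)}` solving the
Clifton–Pohl geodesic equations `x'' = 2x(x')²/(x² + y²)`,
`y'' = 2y(y')²/(x² + y²)` with `γ(0) = (1, 0)` and `γ'(0) = (1, 0)`. -/
theorem cliftonPohl_no_global_geodesic :
    ¬ ∃ x y x' y' x'' y'' : ℝ → ℝ,
      (∀ t : ℝ, (x t, y t) ≠ (0, 0)) ∧
      (∀ t : ℝ, HasDerivAt x (x' t) t) ∧
      (∀ t : ℝ, HasDerivAt y (y' t) t) ∧
      (∀ t : ℝ, HasDerivAt x' (x'' t) t) ∧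
      (∀ t : ℝ, HasDerivAt y' (y'' t) t) ∧
      (∀ t : ℝ, x'' t = 2 * x t * (x' t) ^ 2 / (x t ^ 2 + y t ^ 2)) ∧
      (∀ t : ℝ, y'' t = 2 * y t * (y' t) ^ 2 / (x t ^ 2 + y t ^ 2)) ∧
      x 0 = 1 ∧ y 0 = 0 ∧ x' 0 = 1 ∧ y' 0 = 0 := by
  rintro ⟨x, y, x', y', x'', y'', hne, hx, hy, hx', hy', ex, ey, x0, y0, x0', y0'⟩
  have cx : Continuous x := continuous_iff_continuousAt.2 fun t => (hx t).continuousAt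
  have cy : Continuous y := continuous_iff_continuousAt.2 fun t => (hy t).continuousAt
  have cy' : Continuous y' := continuous_iff_continuousAt.2 fun t => (hy' t).continuousAt
  have hpos : ∀ t, x t ^ 2 + y t ^ 2 ≠ 0 := by
    intro t h
    apply hne t
    have h1 : x t = 0 := by nlinarith [sq_nonneg (x t), sq_nonneg (y t)]
    have h2 : y t = 0 := by nlinarith [sq_nonneg (x t), sq_nonneg (y t)]
    rw [h1, h2]
  have ca : Continuous fun t => 2 * y t * y' t / (x t ^ 2 + y t ^ 2) :=
    Continuous.div (by fun_prop) (by fun_prop) hpos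
  have hA : ∀ t, HasDerivAt (fun t => ∫ s in (0 : ℝ)..t, 2 * y s * y' s / (x s ^ 2 + y s ^ 2))
      (2 * y t * y' t / (x t ^ 2 + y t ^ 2)) t := fun t => ca.integral_hasStrictDerivAt 0 t |>.hasDerivAt
  generalize (fun t => ∫ s in (0 : ℝ)..t, 2 * y s * y' s / (x s ^ 2 + y s ^ 2)) = A at hA
  have hy'0 : ∀ t, y' t = 0 := by
    intro t
    have := const_of_hasDerivAt_zero (fun t => y' t * Real.exp (-A t)) (fun t => by
      refine HasDerivAt.congr_deriv ((hy' t).mul (hA t).neg.exp) ?_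
      rw [ey]
      simp only [Pi.neg_apply]
      ring) t
    simpa [y0', Real.exp_ne_zero] using this
  have hy0 : ∀ t, y t = 0 := by
    intro t
    rw [const_of_hasDerivAt_zero y (fun t => by simpa [hy'0] using hy t) t, y0]
  have hx0 : ∀ t, x t ≠ 0 := by
    intro t h
    exact hne t (by rw [h, hy0])
  have hv : ∀ t, x' t / x t ^ 2 = 1 := by
    intro t
    have := const_of_hasDerivAt_zero (fun t => x' t / x t ^ 2) (fun t => by
      have hh := hx0 t
      refine HasDerivAt.congr_deriv ((hx' t).div ((hx t).pow 2) (pow_ne_zero 2 hh)) ?_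
      rw [ex, hy0]
      norm_num
      left
      field_simp
      ring) t
    simpa [x0, x0'] using this
  have hu := const_of_hasDerivAt_zero (fun t => (x t)⁻¹ + t) (fun t => by
      refine HasDerivAt.congr_deriv (((hx t).inv (hx0 t)).add (hasDerivAt_id t)) ?_
      rw [neg_div, hv]
      norm_num) 1
  simp [x0, hx0] at hu
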